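/- Let G be a free group of finite rank r > 1 with free generating set S, acting on a standard Borel probability space (X, μ) by μ-preserving Borel automorphisms. Suppose f_G(X, μ) is defined, μ is not purely atomic, and f_G(X, μ) ≠ −∞. Then for every 1_G ≠ g ∈ G the restricted action of the cyclic subgroup ⟨g⟩ has infinite Kolmogorov–Sinai entropy: sup{ lim_{k→∞} H(β / ⋁_{m=1}^{k} g^{−m}·β) : β a countable measurable partition of X with H(β) < ∞ } = +∞ (for each such β the sequence H(β / ⋁_{m=1}^{k} g^{−m}·β) is non-increasing in k, so the inner limit exists). -/

import Mathlib

open MeasureTheory Filter Set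
open scoped ENNReal symmDiff Pointwise

namespace FPaper

/-- The free group of rank `r`; its free generating set `S` is `{FreeGroup.of i | i : Fin r}`. -/
abbrev FG (r : ℕ) := FreeGroup (Fin r)

/-- The reduced `S`-word length of a group element. -/
def wlen {r : ℕ} (g : FG r) : ℕ := g.toWord.length

/-- The ball of radius `n` in `FG r` with respect to the word length. -/
def ball (r n : ℕ) : Set (FG r) := {g | wlen g ≤ n}

instance ballFinite (r n : ℕ) : Finite (ball r n) := by
  have h : ball r n ⊆ FreeGroup.mk '' {l : List (Fin r × Bool) | l.length ≤ n} :=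
    fun g hg => ⟨g.toWord, hg, FreeGroup.mk_toWord⟩
  exact (((List.finite_length_le _ n).image _).subset h).to_subtype

/-- An action of a group `G` on a measurable space `X` by Borel automorphisms. -/
structure BorelAction (G : Type*) [Group G] (X : Type*) [MeasurableSpace X] where
  act : G → X → X
  act_one : ∀ x, act 1 x = x
  act_mul : ∀ g h x, act (g * h) x = act g (act h x)
  measurable_act : ∀ g, Measurable (act g)

namespace BorelAction

variable {G X : Type*} [Group G] [mX : MeasurableSpace X]

/-- The action preserves the measure `μ`. -/
def Preserves (T : BorelAction G X) (μ : Measure X) : Prop :=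
  ∀ g : G, MeasurePreserving (T.act g) μ μ

/-- The translated set `g · B`. -/
def smulSet (T : BorelAction G X) (g : G) (B : Set X) : Set X := T.act g⁻¹ ⁻¹' B

/-- The translated partition `g · α`, where a countable measurable partition is recorded
by a (measurable, countably-valued) function whose fibers are the cells. -/
def tr {I : Type*} (T : BorelAction G X) (g : G) (a : X → I) : X → I :=
  fun x => a (T.act g⁻¹ x)

/-- The join `F · α = ⋁_{f ∈ F} f · α` of the translates of a partition over a set `F ⊆ G`. -/
def joinF {I : Type*} (T : BorelAction G X) (F : Set G) (a : X → I) : X → (F → I) :=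
  fun x f => a (T.act (f : G)⁻¹ x)

/-- The σ-algebra generated by the partitions `f · α`, `f ∈ F`. -/
def partSA {I : Type*} (T : BorelAction G X) (F : Set G) (a : X → I) : MeasurableSpace X :=
  ⨆ f ∈ F, MeasurableSpace.comap (T.tr f a) ⊤

/-- The partition `a` is generating: the smallest `G`-invariant σ-algebra containing `a`
(i.e. the one generated by all translates of `a`) contains every measurable set up to
`ν`-null sets. -/
def Generating {I : Type*} (T : BorelAction G X) (a : X → I) (ν : Measure X) : Prop :=
  ∀ B : Set X, MeasurableSet B →
    ∃ B', MeasurableSet[T.partSA Set.univ a] B' ∧ ν (B ∆ B') = 0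


/-- Ergodicity of the action with respect to `ν`. -/
def IsErgodic (T : BorelAction G X) (ν : Measure X) : Prop :=
  ∀ B : Set X, MeasurableSet B → (∀ g : G, ν (T.smulSet g B ∆ B) = 0) → ν B = 0 ∨ ν B = 1

/-- The action is essentially free with respect to `ν`. -/
def EssentiallyFree (T : BorelAction G X) (ν : Measure X) : Prop :=
  ν {x | ∀ g : G, g ≠ 1 → T.act g x ≠ x} = 1

/-- The stabilizer subgroup of a point. -/
def stab (T : BorelAction G X) (y : X) : Subgroup G where
  carrier := {g | T.act g y = y}
  one_mem' := T.act_one y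
  mul_mem' := by
    intro g h hg hh
    simp only [Set.mem_setOf_eq] at *
    rw [T.act_mul, hh, hg]
  inv_mem' := by
    intro g hg
    simp only [Set.mem_setOf_eq] at *
    conv_lhs => rw [← hg]
    rw [← T.act_mul, inv_mul_cancel, T.act_one]

end BorelAction

/-- `m` is a `G`-invariant sub-σ-algebra. -/
def InvariantSA {G X : Type*} [Group G] (m : MeasurableSpace X) [mX : MeasurableSpace X]
    (T : BorelAction G X) : Prop :=
  m ≤ mX ∧ ∀ (g : G) (B : Set X), MeasurableSet[m] B → MeasurableSet[m] (T.act g ⁻¹' B)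

/-- A measure is purely atomic: the set of atoms has full measure. -/
def PurelyAtomic {X : Type*} [MeasurableSpace X] (ν : Measure X) : Prop :=
  ν {x | 0 < ν {x}} = 1

/-- Shannon entropy of a countable measurable partition (recorded as a countably-valued
function), with values in `[0, ∞]`. -/
noncomputable def Hpart {X I : Type*} [MeasurableSpace X] [Countable I]
    (μ : Measure X) (a : X → I) : ℝ≥0∞ :=
  ∑' i : I, ENNReal.ofReal (Real.negMulLog (μ (a ⁻¹' {i})).toReal)

/-- Conditional Shannon entropy of a countable partition given a sub-σ-algebra `m`:
`H(α/m) = ∫ ∑_{A ∈ α} φ(E[1_A | m](x)) dμ(x)` with `φ(t) = -t log t`. -/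
noncomputable def condEntS {X I : Type*} (m : MeasurableSpace X) [mX : MeasurableSpace X]
    [Countable I] (μ : Measure X) (a : X → I) : ℝ≥0∞ :=
  ∫⁻ x, ∑' i : I,
    ENNReal.ofReal (Real.negMulLog ((μ[(a ⁻¹' {i}).indicator (fun _ => (1:ℝ)) | m]) x)) ∂μ

/-- Conditional Shannon entropy of a partition given another partition:
`H(α/β) = ∑_{B ∈ β} ∑_{A ∈ α} -μ(B) · (μ(A∩B)/μ(B)) · log (μ(A∩B)/μ(B))`
(equivalently `H(α ∨ β) − H(β)`), with values in `[0, ∞]`. -/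
noncomputable def condEntP {X I J : Type*} [MeasurableSpace X] [Countable I] [Countable J]
    (μ : Measure X) (a : X → I) (b : X → J) : ℝ≥0∞ :=
  ∑' q : I × J, μ (b ⁻¹' {q.2}) *
    ENNReal.ofReal (Real.negMulLog
      ((μ (a ⁻¹' {q.1} ∩ b ⁻¹' {q.2})).toReal / (μ (b ⁻¹' {q.2})).toReal))

/-- `F_G(X, μ, S, β) = (1-2r)·H(β) + ∑_{s ∈ S} H(s·β ∨ β)`. -/
noncomputable def FF {r : ℕ} {X I : Type*} [MeasurableSpace X] [Countable I]
    (μ : Measure X) (T : BorelAction (FG r) X) (b : X → I) : ℝ :=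
  (1 - 2 * (r : ℝ)) * (Hpart μ b).toReal
    + ∑ i : Fin r, (Hpart μ (fun x => (T.tr (FreeGroup.of i) b x, b x))).toReal

/-- The sequence `n ↦ F_G(X, μ, S, B_n · α)`. -/
noncomputable def fSeq {r : ℕ} {X : Type*} [MeasurableSpace X]
    (μ : Measure X) (T : BorelAction (FG r) X) (a : X → ℕ) (n : ℕ) : ℝ :=
  FF μ T (T.joinF (ball r n) a)

/-- The f-invariant entropy `f_G(X, μ) = lim_n F_G(X, μ, S, B_n·α)`, the limit (= infimum,
since the sequence is non-increasing) of the sequence `fSeq`, with values in `[-∞, ∞)`. -/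
noncomputable def fInv {r : ℕ} {X : Type*} [MeasurableSpace X]
    (μ : Measure X) (T : BorelAction (FG r) X) (a : X → ℕ) : EReal :=
  ⨅ n : ℕ, ((fSeq μ T a n : ℝ) : EReal)

/-- Relative version `F_G(X, μ/Σ, S, β) = (1-2r)·H(β/Σ) + ∑_{s ∈ S} H(s·β ∨ β / Σ)`. -/
noncomputable def FFrel {r : ℕ} {X I : Type*} (m : MeasurableSpace X) [mX : MeasurableSpace X]
    [Countable I] (μ : Measure X) (T : BorelAction (FG r) X) (b : X → I) : ℝ :=
  (1 - 2 * (r : ℝ)) * (condEntS m μ b).toReal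
    + ∑ i : Fin r, (condEntS m μ (fun x => (T.tr (FreeGroup.of i) b x, b x))).toReal

/-- The sequence `n ↦ F_G(X, μ/Σ, S, B_n · α)`. -/
noncomputable def fSeqRel {r : ℕ} {X : Type*} (m : MeasurableSpace X) [mX : MeasurableSpace X]
    (μ : Measure X) (T : BorelAction (FG r) X) (a : X → ℕ) (n : ℕ) : ℝ :=
  FFrel m μ T (T.joinF (ball r n) a)

/-- The relative f-invariant entropy `f_G(X, μ/Σ)`, with values in `[-∞, ∞)`. -/
noncomputable def fInvRel {r : ℕ} {X : Type*} (m : MeasurableSpace X) [mX : MeasurableSpace X]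
    (μ : Measure X) (T : BorelAction (FG r) X) (a : X → ℕ) : EReal :=
  ⨅ n : ℕ, ((fSeqRel m μ T a n : ℝ) : EReal)

/-- A total order on `S ∪ S⁻¹` is recorded by an injection `ord : Fin r × Bool → ℕ`;
`g ≺ h` iff `|g| < |h|`, or `|g| = |h|` and the reduced word of `g` lexicographically
precedes that of `h`. -/
def wlt {r : ℕ} (ord : Fin r × Bool → ℕ) (g h : FG r) : Prop :=
  wlen g < wlen h ∨ (wlen g = wlen h ∧ List.Lex (fun p q => ord p < ord q) g.toWord h.toWord)

/-- `Pre(g)`: the set of elements strictly preceding `g`. -/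
def Pre {r : ℕ} (ord : Fin r × Bool → ℕ) (g : FG r) : Set (FG r) := {h | wlt ord h g}

/-- The generator or inverse generator corresponding to a letter. -/
def letter {r : ℕ} (p : Fin r × Bool) : FG r :=
  if p.2 then FreeGroup.of p.1 else (FreeGroup.of p.1)⁻¹

/-- The first (leftmost) letter of the reduced word of `g` (junk value `1` for `g = 1`). -/
def firstLetter {r : ℕ} (g : FG r) : FG r := ((g.toWord.head?).map letter).getD 1

/-- The independence decay `δ(g, α/Σ)`, as a real number:
`δ(g, α/Σ) = H(s⁻¹g·α / Pre(s⁻¹g)·α ∨ Σ) − H(g·α / Pre(g)·α ∨ Σ)` where `s` is the first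
letter of `g`. -/
noncomputable def idecay {r : ℕ} {X I : Type*} (m : MeasurableSpace X) [mX : MeasurableSpace X]
    [Countable I] (μ : Measure X) (T : BorelAction (FG r) X)
    (ord : Fin r × Bool → ℕ) (a : X → I) (g : FG r) : ℝ :=
  (condEntS (m ⊔ T.partSA (Pre ord ((firstLetter g)⁻¹ * g)) a) μ
      (T.tr ((firstLetter g)⁻¹ * g) a)).toReal
  - (condEntS (m ⊔ T.partSA (Pre ord g) a) μ (T.tr g a)).toReal

/-- The entropy `H(τ)` of a probability space: the supremum of the Shannon entropies of
finite measurable partitions. -/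
noncomputable def measEnt {M : Type*} [MeasurableSpace M] (τ : Measure M) : ℝ≥0∞ :=
  ⨆ (P : Finset (Set M)) (_ : ∀ p ∈ P, MeasurableSet p)
    (_ : (P : Set (Set M)).PairwiseDisjoint id) (_ : ⋃₀ (P : Set (Set M)) = Set.univ),
    ∑ p ∈ P, ENNReal.ofReal (Real.negMulLog (τ p).toReal)

/-- The non-negative part of an extended real, in `ℝ≥0∞`. -/
noncomputable def erealToENNReal (x : EReal) : ℝ≥0∞ :=
  if x = ⊤ then ⊤ else ENNReal.ofReal x.toReal

/-- The integral of an `EReal`-valued function (positive part minus negative part),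
with values in `[-∞, ∞]`. -/
noncomputable def eIntegral {M : Type*} [MeasurableSpace M] (τ : Measure M) (f : M → EReal) :
    EReal :=
  ((∫⁻ m, erealToENNReal (f m) ∂τ : ℝ≥0∞) : EReal)
    - ((∫⁻ m, erealToENNReal (-(f m)) ∂τ : ℝ≥0∞) : EReal)

/-- The set of `G`-invariant Borel probability measures on `X`. -/
def InvProb {G X : Type*} [Group G] [MeasurableSpace X] (T : BorelAction G X) :
    Set (Measure X) :=
  {ν | IsProbabilityMeasure ν ∧ ∀ g : G, MeasurePreserving (T.act g) ν ν}

/-- A monotone submodular left-invariant function on the finite subsets of a group. -/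
structure IsInvariantSubmodular {G : Type*} [Group G] [DecidableEq G] (h : Finset G → ℝ) :
    Prop where
  mono : Monotone h
  submod : ∀ A B : Finset G, h (A ∪ B) + h (A ∩ B) ≤ h A + h B
  smul : ∀ (g : G) (A : Finset G), h (g • A) = h A
  empty : h ∅ = 0

section Combinatorics

/-- The marginal value of adding `g` to the set `P`. -/
def gain {G : Type*} [DecidableEq G] (h : Finset G → ℝ) (P : Finset G) (g : G) : ℝ :=
  h (insert g P) - h P

lemma sub_eq_sum_gain {G : Type*} [DecidableEq G] {α : Type*} [LinearOrder α] {key : G → α}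
    (hkey : Function.Injective key) (h : Finset G → ℝ) (P E : Finset G) :
    h (P ∪ E) - h P = ∑ e ∈ E, gain h (P ∪ E.filter (fun x => key x < key e)) e := by
  induction E using Finset.induction_on_max_value key with
  | empty => simp
  | insert a s ha hmax ih =>
    have hlt : ∀ x ∈ s, key x < key a := fun x hx =>
      lt_of_le_of_ne (hmax x hx) fun hxa => ha (hkey hxa ▸ hx)
    rw [Finset.sum_insert ha]
    have h1 : (insert a s).filter (fun x => key x < key a) = s := by
      rw [Finset.filter_insert, if_neg (lt_irrefl _), Finset.filter_true_of_mem hlt]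
    have h2 : ∀ e ∈ s, (insert a s).filter (fun x => key x < key e)
        = s.filter (fun x => key x < key e) := fun e he => by
      rw [Finset.filter_insert, if_neg (not_lt.2 (hmax e he))]
    rw [h1, Finset.sum_congr rfl fun e he => by rw [h2 e he], ← ih, Finset.union_insert]
    unfold gain
    ring

namespace IsInvariantSubmodular

variable {G : Type*} [Group G] [DecidableEq G] {h : Finset G → ℝ}

lemma gain_nonneg (hh : IsInvariantSubmodular h) (P : Finset G) (g : G) : 0 ≤ gain h P g :=
  sub_nonneg.2 (hh.mono (Finset.subset_insert g P))

lemma gain_anti (hh : IsInvariantSubmodular h) {P Q : Finset G} (hPQ : P ⊆ Q) (g : G) :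
    gain h Q g ≤ gain h P g := by
  have h1 := hh.submod (insert g P) Q
  have h2 : insert g P ∪ Q = insert g Q := by
    rw [Finset.insert_union, Finset.union_eq_right.2 hPQ]
  have h3 : h P ≤ h (insert g P ∩ Q) :=
    hh.mono (Finset.subset_inter (Finset.subset_insert g P) hPQ)
  rw [h2] at h1
  unfold gain
  linarith

lemma gain_smul (hh : IsInvariantSubmodular h) (P : Finset G) (t g : G) :
    gain h (t • P) (t * g) = gain h P g := by
  unfold gain
  rw [← hh.smul t P, ← hh.smul t (insert g P), Finset.smul_finset_insert, smul_eq_mul]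

end IsInvariantSubmodular

variable {r : ℕ}

/-- The length-lexicographic rank of a group element. -/
def key (g : FG r) : ℕ ×ₗ List ℕ := toLex (wlen g, g.toWord.map Encodable.encode)

lemma key_injective : Function.Injective (key (r := r)) := by
  intro g k hgk
  have : g.toWord.map Encodable.encode = k.toWord.map Encodable.encode :=
    congrArg (fun x => (ofLex x).2) hgk
  exact FreeGroup.toWord_injective (List.map_injective_iff.2 Encodable.encode_injective this)

lemma key_lt_of_wlen_lt {g k : FG r} (hgk : wlen g < wlen k) : key g < key k :=
  Prod.Lex.toLex_lt_toLex.2 (Or.inl hgk)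

lemma wlen_le_of_key_lt {g k : FG r} (hgk : key g < key k) : wlen g ≤ wlen k := by
  rcases Prod.Lex.toLex_lt_toLex.1 hgk with h | h
  · exact h.le
  · exact h.1.le

lemma toWord_letter_mul (t : Fin r × Bool) (g : FG r) :
    (FreeGroup.mk [t] * g).toWord = (t :: g.toWord) ∨
      (g.toWord = (t.1, !t.2) :: (FreeGroup.mk [t] * g).toWord) := by
  have h1 : (FreeGroup.mk [t] * g).toWord = FreeGroup.reduce (t :: g.toWord) := by
    rw [FreeGroup.toWord_mul, FreeGroup.toWord_mk, FreeGroup.reduce_singleton, List.singleton_append]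
  rw [h1, FreeGroup.reduce.cons, FreeGroup.reduce_toWord]
  cases hw : g.toWord with
  | nil => simp
  | cons hd tl =>
    by_cases hc : t.1 = hd.1 ∧ t.2 = !hd.2
    · right
      simp only [hc, and_self, if_true]
      ext1
      all_goals simp
    · left
      simp [hc]

lemma wlen_letter_mul (t : Fin r × Bool) (g : FG r) :
    wlen (FreeGroup.mk [t] * g) = wlen g + 1 ∨ wlen g = wlen (FreeGroup.mk [t] * g) + 1 := by
  rcases toWord_letter_mul t g with h | h
  · left; simp [wlen, h]
  · right; rw [wlen, h]; simp [wlen]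

lemma wlen_letter_mul_le (t : Fin r × Bool) (g : FG r) :
    wlen (FreeGroup.mk [t] * g) ≤ wlen g + 1 := by
  rcases wlen_letter_mul t g with h | h <;> omega

lemma toWord_letter_mul_of_wlen {t : Fin r × Bool} {g : FG r}
    (ht : wlen (FreeGroup.mk [t] * g) = wlen g + 1) :
    (FreeGroup.mk [t] * g).toWord = t :: g.toWord := by
  rcases toWord_letter_mul t g with h | h
  · exact h
  · have := congrArg List.length h
    simp only [List.length_cons] at this
    simp only [wlen] at ht
    omega

lemma key_letter_mul_lt {t : Fin r × Bool} {g k : FG r} (hkg : key k < key g)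
    (ht : wlen (FreeGroup.mk [t] * g) = wlen g + 1) :
    key (FreeGroup.mk [t] * k) < key (FreeGroup.mk [t] * g) := by
  rcases Prod.Lex.toLex_lt_toLex.1 hkg with h | ⟨h1, h2⟩
  · apply key_lt_of_wlen_lt
    have := wlen_letter_mul_le t k
    simp only at h
    omega
  · simp only at h1 h2
    rcases wlen_letter_mul t k with h | h
    · refine Prod.Lex.toLex_lt_toLex.2 (Or.inr ⟨by simp only; omega, ?_⟩)
      simp only [toWord_letter_mul_of_wlen h, toWord_letter_mul_of_wlen ht, List.map_cons]
      exact List.cons_lt_cons_iff.2 (Or.inr ⟨rfl, h2⟩)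
    · apply key_lt_of_wlen_lt
      omega

/-- The ball of radius `n` as a finite set. -/
noncomputable def ballFin (r n : ℕ) : Finset (FG r) := (Set.toFinite (ball r n)).toFinset

lemma mem_ballFin {n : ℕ} {g : FG r} : g ∈ ballFin r n ↔ wlen g ≤ n := by
  simp [ballFin, ball]

/-- The sphere of radius `n` as a finite set. -/
noncomputable def sphere (r n : ℕ) : Finset (FG r) := (ballFin r n).filter (fun g => wlen g = n)

lemma mem_sphere {n : ℕ} {g : FG r} : g ∈ sphere r n ↔ wlen g = n := by
  simp only [sphere, Finset.mem_filter, mem_ballFin]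
  omega

/-- The elements of the sphere of radius `n` whose product with the letter `t` does not cancel. -/
noncomputable def extendable (n : ℕ) (t : Fin r × Bool) : Finset (FG r) :=
  (sphere r n).filter (fun g => wlen (FreeGroup.mk [t] * g) = n + 1)

lemma mem_extendable {n : ℕ} {t : Fin r × Bool} {g : FG r} :
    g ∈ extendable n t ↔ wlen g = n ∧ wlen (FreeGroup.mk [t] * g) = n + 1 := by
  simp only [extendable, Finset.mem_filter, mem_sphere]

/-- The finite set of elements preceding `g` in the length-lexicographic order. -/
noncomputable def preFin (g : FG r) : Finset (FG r) :=
  (ballFin r (wlen g)).filter (fun k => key k < key g)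

lemma mem_preFin {g k : FG r} : k ∈ preFin g ↔ key k < key g := by
  simp only [preFin, Finset.mem_filter, mem_ballFin, and_iff_right_iff_imp]
  exact wlen_le_of_key_lt

/-- The gain of `g` over all its predecessors. -/
noncomputable def newGain (h : Finset (FG r) → ℝ) (g : FG r) : ℝ := gain h (preFin g) g

variable {h : Finset (FG r) → ℝ}

lemma newGain_letter_mul_le (hh : IsInvariantSubmodular h) {n : ℕ} {t : Fin r × Bool} {g : FG r}
    (hg : g ∈ extendable n t) : newGain h (FreeGroup.mk [t] * g) ≤ newGain h g := by
  obtain ⟨h1, h2⟩ := mem_extendable.1 hg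
  rw [newGain, newGain, ← hh.gain_smul (preFin g) (FreeGroup.mk [t]) g]
  refine hh.gain_anti (fun x hx => ?_) _
  obtain ⟨k, hk, rfl⟩ := Finset.mem_smul_finset.1 hx
  exact mem_preFin.2 (key_letter_mul_lt (mem_preFin.1 hk) (by omega))

lemma sum_newGain_le (hh : IsInvariantSubmodular h) {P E : Finset (FG r)}
    (hP : ∀ e ∈ E, P ⊆ preFin e) : ∑ e ∈ E, newGain h e ≤ h (P ∪ E) - h P := by
  rw [sub_eq_sum_gain key_injective]
  refine Finset.sum_le_sum fun e he => hh.gain_anti (Finset.union_subset (hP e he) fun x hx => ?_) _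
  exact mem_preFin.2 (Finset.mem_filter.1 hx).2

lemma le_sum_newGain (hh : IsInvariantSubmodular h) {P E : Finset (FG r)}
    (hP : ∀ e ∈ E, ∀ k ∈ preFin e, k ∈ P ∨ k ∈ E) :
    h (P ∪ E) - h P ≤ ∑ e ∈ E, newGain h e := by
  rw [sub_eq_sum_gain key_injective]
  refine Finset.sum_le_sum fun e he => hh.gain_anti (fun k hk => ?_) _
  rw [Finset.mem_union, Finset.mem_filter]
  exact (hP e he k hk).imp id fun hE => ⟨hE, mem_preFin.1 hk⟩

lemma sum_ballFin_newGain (hh : IsInvariantSubmodular h) (n : ℕ) :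
    ∑ g ∈ ballFin r n, newGain h g = h (ballFin r n) := by
  have h1 := sum_newGain_le hh (P := ∅) (E := ballFin r n) (by simp)
  have h2 := le_sum_newGain hh (P := ∅) (E := ballFin r n) fun e he k hk =>
    Or.inr (mem_ballFin.2 ((wlen_le_of_key_lt (mem_preFin.1 hk)).trans (mem_ballFin.1 he)))
  rw [Finset.empty_union, hh.empty] at h1 h2
  linarith

/-- The total gain of the sphere of radius `n`. -/
noncomputable def sphereGain (h : Finset (FG r) → ℝ) (n : ℕ) : ℝ :=
  ∑ g ∈ sphere r n, newGain h g

lemma sphereGain_nonneg (hh : IsInvariantSubmodular h) (n : ℕ) : 0 ≤ sphereGain h n :=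
  Finset.sum_nonneg fun _ _ => hh.gain_nonneg _ _

lemma ballFin_succ (hh : IsInvariantSubmodular h) (n : ℕ) :
    h (ballFin r (n + 1)) = h (ballFin r n) + sphereGain h (n + 1) := by
  rw [← sum_ballFin_newGain hh, ← sum_ballFin_newGain hh, sphereGain, ← Finset.sum_union]
  · congr 1
    ext g
    simp only [Finset.mem_union, mem_ballFin, mem_sphere]
    omega
  · rw [Finset.disjoint_left]
    intro g hg hg'
    rw [mem_ballFin] at hg
    rw [mem_sphere] at hg'
    omega

lemma letter_smul_union_le (hh : IsInvariantSubmodular h) (n : ℕ) (t : Fin r × Bool) :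
    h (FreeGroup.mk [t] • ballFin r n ∪ ballFin r n) - h (ballFin r n)
      ≤ ∑ g ∈ extendable n t, newGain h g := by
  set u : FG r := FreeGroup.mk [t] with hu
  have key1 : ∀ k : FG r, wlen k ≤ n → k ∈ u⁻¹ • ballFin r n ∨ k ∈ extendable n t := by
    intro k hk
    by_cases hc : wlen (u * k) ≤ n
    · left
      exact Finset.mem_smul_finset.2 ⟨u * k, mem_ballFin.2 hc, by simp⟩
    · right
      have := wlen_letter_mul_le t k
      rw [← hu] at this
      exact mem_extendable.2 ⟨by omega, by rw [← hu]; omega⟩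
  have h1 := le_sum_newGain hh (P := u⁻¹ • ballFin r n) (E := extendable n t) fun e he k hk =>
    key1 k ((wlen_le_of_key_lt (mem_preFin.1 hk)).trans (mem_extendable.1 he).1.le)
  have h2 : h (u • ballFin r n ∪ ballFin r n) ≤ h (u⁻¹ • ballFin r n ∪ extendable n t) := by
    rw [← hh.smul u⁻¹ (u • ballFin r n ∪ ballFin r n), Finset.smul_finset_union, inv_smul_smul]
    refine hh.mono (Finset.union_subset (fun k hk => ?_) Finset.subset_union_left)
    exact Finset.mem_union.2 (key1 k (mem_ballFin.1 hk))
  rw [hh.smul] at h1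
  linarith

lemma sum_sphere_succ (φ : FG r → ℝ) (n : ℕ) :
    ∑ g ∈ sphere r (n + 1), φ g
      = ∑ t : Fin r × Bool, ∑ g ∈ extendable n t, φ (FreeGroup.mk [t] * g) := by
  rw [Finset.sum_sigma']
  symm
  refine Finset.sum_bij (fun p _ => FreeGroup.mk [p.1] * p.2) ?_ ?_ ?_ ?_
  · rintro ⟨t, g⟩ hp
    simp only [Finset.mem_sigma, Finset.mem_univ, true_and] at hp
    exact mem_sphere.2 (mem_extendable.1 hp).2
  · rintro ⟨t, g⟩ hp ⟨t', g'⟩ hp' heq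
    simp only [Finset.mem_sigma, Finset.mem_univ, true_and, mem_extendable] at hp hp' heq
    have h1 := toWord_letter_mul_of_wlen (t := t) (g := g) (by omega)
    have h2 := toWord_letter_mul_of_wlen (t := t') (g := g') (by omega)
    rw [heq, h2, List.cons.injEq] at h1
    obtain ⟨rfl, h3⟩ := h1
    rw [FreeGroup.toWord_injective h3]
  · intro g hg
    rw [mem_sphere] at hg
    cases hw : g.toWord with
    | nil => simp [wlen, hw] at hg
    | cons t l =>
      have hl : FreeGroup.IsReduced l :=
        FreeGroup.isReduced_toWord.infix (L₂ := g.toWord) ⟨[t], [], by simp [hw]⟩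
      have hg' : FreeGroup.mk [t] * FreeGroup.mk l = g := by
        rw [← FreeGroup.mk_toWord (x := g), hw, FreeGroup.mul_mk, List.singleton_append]
      have hlen : wlen (FreeGroup.mk l : FG r) = n := by
        rw [wlen, FreeGroup.toWord_mk, hl.reduce_eq]
        simpa [wlen, hw] using hg
      refine ⟨⟨t, FreeGroup.mk l⟩, ?_, hg'⟩
      simp only [Finset.mem_sigma, Finset.mem_univ, true_and, mem_extendable]
      exact ⟨hlen, by rw [hg', hg]⟩
  · intro _ _
    rfl

lemma card_extending {n : ℕ} {g : FG r} (hg : g ∈ sphere r (n + 1)) :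
    ((Finset.univ.filter fun t : Fin r × Bool => g ∈ extendable (n + 1) t).card : ℝ)
      = 2 * r - 1 := by
  rw [mem_sphere] at hg
  cases hw : g.toWord with
  | nil => simp [wlen, hw] at hg
  | cons s l =>
    have h1 : (Finset.univ.filter fun t : Fin r × Bool => g ∈ extendable (n + 1) t)
        = Finset.univ.erase (s.1, !s.2) := by
      ext t
      simp only [Finset.mem_filter, Finset.mem_univ, true_and, Finset.mem_erase, and_true,
        mem_extendable, hg]
      rcases toWord_letter_mul t g with h | h
      · have hlen : wlen (FreeGroup.mk [t] * g) = n + 1 + 1 := by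
          rw [← hg]; simp [wlen, h]
        simp only [hlen, true_iff]
        rintro rfl
        have : FreeGroup.IsReduced ((s.1, !s.2) :: s :: l) := by
          rw [← hw, ← h]; exact FreeGroup.isReduced_toWord
        simp [FreeGroup.IsReduced] at this
      · have hlen : wlen (FreeGroup.mk [t] * g) + 1 = n + 1 := by
          rw [← hg]; rw [wlen, wlen]; conv_rhs => rw [h]
          simp
        have : wlen (FreeGroup.mk [t] * g) ≠ n + 1 + 1 := by omega
        simp only [this, false_iff, not_not]
        rw [hw, List.cons.injEq] at h
        rw [h.1]
        simp
    rw [h1, Finset.card_erase_of_mem (Finset.mem_univ _)]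
    simp only [Finset.card_univ, Fintype.card_prod, Fintype.card_fin, Fintype.card_bool]
    have : 0 < r := Fin.pos s.1
    rw [Nat.cast_sub (by omega)]
    push_cast
    ring

lemma sum_extendable (φ : FG r → ℝ) (n : ℕ) :
    ∑ t : Fin r × Bool, ∑ g ∈ extendable (n + 1) t, φ g
      = (2 * r - 1) * ∑ g ∈ sphere r (n + 1), φ g := by
  have h1 : ∀ t : Fin r × Bool, ∑ g ∈ extendable (n + 1) t, φ g
      = ∑ g ∈ sphere r (n + 1), if g ∈ extendable (n + 1) t then φ g else 0 := by
    intro t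
    rw [← Finset.sum_filter]
    congr 1
    ext g
    simp only [Finset.mem_filter, mem_sphere, mem_extendable]
    tauto
  simp only [h1]
  rw [Finset.sum_comm, Finset.mul_sum]
  refine Finset.sum_congr rfl fun g hg => ?_
  rw [← Finset.sum_filter, Finset.sum_const, nsmul_eq_mul, card_extending hg]

/-- A potential that decreases by the total independence decay from one sphere to the next. -/
noncomputable def potential (h : Finset (FG r) → ℝ) (n : ℕ) : ℝ :=
  (2 * r - 1) * sphereGain h n - (2 * r - 2) * h (ballFin r n)

lemma potential_sub_succ (hh : IsInvariantSubmodular h) (n : ℕ) :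
    potential h (n + 1) - potential h (n + 2)
      = (2 * r - 1) * sphereGain h (n + 1) - sphereGain h (n + 2) := by
  rw [potential, potential, ballFin_succ hh (n + 1)]
  ring

lemma sum_sub_le_potential (hh : IsInvariantSubmodular h) (n : ℕ) (t : Fin r × Bool)
    {E : Finset (FG r)} (hE : E ⊆ extendable (n + 1) t) :
    ∑ g ∈ E, (newGain h g - newGain h (FreeGroup.mk [t] * g))
      ≤ potential h (n + 1) - potential h (n + 2) := by
  rw [potential_sub_succ hh, sphereGain, ← sum_extendable, sphereGain, sum_sphere_succ,
    ← Finset.sum_sub_distrib]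
  simp only [← Finset.sum_sub_distrib]
  have hnn : ∀ s : Fin r × Bool, ∀ g ∈ extendable (n + 1) s,
      0 ≤ newGain h g - newGain h (FreeGroup.mk [s] * g) := fun s g hg =>
    sub_nonneg.2 (newGain_letter_mul_le hh hg)
  refine (Finset.sum_le_sum_of_subset_of_nonneg hE fun g hg _ => hnn t g hg).trans ?_
  exact Finset.single_le_sum (f := fun s => ∑ g ∈ extendable (n + 1) s,
    (newGain h g - newGain h (FreeGroup.mk [s] * g)))
    (fun s _ => Finset.sum_nonneg (hnn s)) (Finset.mem_univ t)

lemma potential_succ_le (hh : IsInvariantSubmodular h) (hr : 1 < r) (n : ℕ) :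
    potential h (n + 1) ≤ potential h 1 := by
  induction n with
  | zero => rfl
  | succ n ih =>
    have := sum_sub_le_potential hh n (⟨0, by omega⟩, true) (Finset.empty_subset _)
    rw [Finset.sum_empty] at this
    linarith

lemma toWord_mk_mul {L : List (Fin r × Bool)} {g : FG r}
    (hL : FreeGroup.IsReduced (L ++ g.toWord)) :
    (FreeGroup.mk L * g).toWord = L ++ g.toWord := by
  conv_lhs => rw [← FreeGroup.mk_toWord (x := g)]
  rw [FreeGroup.mul_mk, FreeGroup.toWord_mk, hL.reduce_eq]

lemma sum_sub_mk_mul_le (hh : IsInvariantSubmodular h) (n : ℕ) {E : Finset (FG r)}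
    (L : List (Fin r × Bool)) (hE : ∀ g ∈ E, wlen g = n + 1)
    (hL : ∀ g ∈ E, FreeGroup.IsReduced (L ++ g.toWord)) :
    ∑ g ∈ E, (newGain h g - newGain h (FreeGroup.mk L * g))
      ≤ potential h (n + 1) - potential h (n + 1 + L.length) := by
  induction L with
  | nil =>
    simp [← FreeGroup.one_eq_mk]
  | cons t L ih =>
    have hL' : ∀ g ∈ E, FreeGroup.IsReduced (L ++ g.toWord) := fun g hg =>
      (hL g hg).infix ⟨[t], [], by simp⟩
    have h1 := ih hL'
    have hmul : ∀ g : FG r, FreeGroup.mk (t :: L) * g = FreeGroup.mk [t] * (FreeGroup.mk L * g) := by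
      intro g
      rw [← mul_assoc, FreeGroup.mul_mk, List.singleton_append]
    have hsub : E.image (fun g => FreeGroup.mk L * g) ⊆ extendable (n + L.length + 1) t := by
      intro x hx
      obtain ⟨g, hg, rfl⟩ := Finset.mem_image.1 hx
      have := hE g hg
      rw [mem_extendable, ← hmul, wlen, wlen, toWord_mk_mul (hL g hg), toWord_mk_mul (hL' g hg)]
      simp only [wlen] at this
      simp only [List.length_append, List.length_cons]
      omega
    have h2 := sum_sub_le_potential hh (n + L.length) t hsub
    rw [Finset.sum_image (fun _ _ _ _ => mul_left_cancel)] at h2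
    have h3 : ∑ g ∈ E, (newGain h g - newGain h (FreeGroup.mk (t :: L) * g))
        = ∑ g ∈ E, (newGain h g - newGain h (FreeGroup.mk L * g))
          + ∑ g ∈ E, (newGain h (FreeGroup.mk L * g)
            - newGain h (FreeGroup.mk [t] * (FreeGroup.mk L * g))) := by
      rw [← Finset.sum_add_distrib]
      refine Finset.sum_congr rfl fun g _ => ?_
      rw [hmul]
      ring
    have e1 : n + 1 + L.length = n + L.length + 1 := by omega
    have e2 : n + 1 + (t :: L).length = n + L.length + 2 := by simp; omega
    rw [h3, e2]
    rw [e1] at h1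
    linarith

lemma potential_lower_bound (hh : IsInvariantSubmodular h) (n : ℕ) :
    2 * ((1 - 2 * r) * h (ballFin r (n + 1))
      + ∑ i : Fin r, h (FreeGroup.of i • ballFin r (n + 1) ∪ ballFin r (n + 1)))
      ≤ potential h (n + 1) := by
  set B := ballFin r (n + 1) with hB
  have h1 : ∀ i : Fin r, 2 * (h (FreeGroup.of i • B ∪ B) - h B)
      ≤ ∑ b : Bool, ∑ g ∈ extendable (n + 1) (i, b), newGain h g := by
    intro i
    have h2 := letter_smul_union_le hh (n + 1) (i, true)
    have h3 := letter_smul_union_le hh (n + 1) (i, false)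
    have h4 : (FreeGroup.mk [(i, false)] : FG r) = (FreeGroup.of i)⁻¹ := rfl
    have h5 : (FreeGroup.mk [(i, true)] : FG r) = FreeGroup.of i := rfl
    rw [← hB, h4, ← hh.smul (FreeGroup.of i), Finset.smul_finset_union, smul_inv_smul,
      Finset.union_comm] at h3
    rw [← hB, h5] at h2
    rw [Fintype.sum_bool]
    linarith
  have h6 := Finset.sum_le_sum fun i (_ : i ∈ Finset.univ) => h1 i
  rw [← Fintype.sum_prod_type (f := fun t : Fin r × Bool => ∑ g ∈ extendable (n + 1) t, newGain h g),
    sum_extendable, ← Finset.mul_sum, Finset.sum_sub_distrib, Finset.sum_const, Finset.card_univ,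
    Fintype.card_fin, nsmul_eq_mul] at h6
  rw [potential, sphereGain]
  linarith

lemma sphereGain_sub_le (hh : IsInvariantSubmodular h) (n : ℕ) (t : Fin r × Bool) :
    sphereGain h (n + 1) - sphereGain h n
      ≤ ∑ g ∈ (sphere r (n + 1)).filter (fun g => g.toWord.head? ≠ some t), newGain h g := by
  have h1 : ∑ g ∈ (sphere r (n + 1)).filter (fun g => ¬ g.toWord.head? ≠ some t), newGain h g
      ≤ sphereGain h n := by
    rw [Finset.sum_filter, sum_sphere_succ, Finset.sum_eq_single t]
    · calc _ ≤ ∑ g ∈ extendable n t, newGain h g := by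
            refine Finset.sum_le_sum fun g hg => ?_
            split_ifs
            · exact hh.gain_nonneg _ _
            · exact newGain_letter_mul_le hh hg
        _ ≤ _ := Finset.sum_le_sum_of_subset_of_nonneg (Finset.filter_subset _ _)
            fun _ _ _ => hh.gain_nonneg _ _
    · intro s _ hs
      refine Finset.sum_eq_zero fun g hg => ?_
      obtain ⟨h2, h3⟩ := mem_extendable.1 hg
      rw [toWord_letter_mul_of_wlen (by omega)]
      simp [hs]
    · simp
  have h2 := Finset.sum_filter_add_sum_filter_not (sphere r (n + 1))
    (fun g => g.toWord.head? ≠ some t) (newGain h)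
  rw [sphereGain]
  linarith

lemma exists_large_filtered_sum (hh : IsInvariantSubmodular h) (hr : 1 < r) {C : ℝ}
    (hC : ∀ n, C ≤ potential h (n + 1)) (hunb : ∀ M, ∃ n, M ≤ h (ballFin r n))
    (t : Fin r × Bool) (M : ℝ) :
    ∃ n, M ≤ ∑ g ∈ (sphere r (n + 1)).filter (fun g => g.toWord.head? ≠ some t),
      newGain h g := by
  have hr' : (2 : ℝ) ≤ r := by exact_mod_cast hr
  set M' := |M| + |potential h 1| + |C| with hM'
  obtain ⟨n, hn⟩ := hunb ((2 * r - 1) * M' + |C|)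
  have hn1 : (2 * r - 1) * M' + |C| ≤ h (ballFin r (n + 1)) := by
    rw [ballFin_succ hh]
    linarith [sphereGain_nonneg hh (n + 1)]
  have hA : M' ≤ sphereGain h (n + 1) := by
    have h1 := hC n
    rw [potential] at h1
    have hM0 : 0 ≤ M' := by positivity
    have h2 : (2 * r - 1) * M' ≤ (2 * r - 1) * sphereGain h (n + 1) := by
      have h3 := neg_abs_le C
      nlinarith [mul_nonneg (show (0 : ℝ) ≤ 2 * r - 1 by linarith) hM0, abs_nonneg C]
    exact le_of_mul_le_mul_left h2 (by linarith)
  refine ⟨n + 1, le_trans ?_ (sphereGain_sub_le hh (n + 1) t)⟩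
  have h4 := potential_sub_succ hh n
  have h5 := potential_succ_le hh hr n
  have h6 := hC (n + 1)
  have h7 : sphereGain h (n + 1) ≤ (2 * r - 2) * sphereGain h (n + 1) := by
    nlinarith [sphereGain_nonneg hh (n + 1)]
  have : n + 1 + 1 = n + 2 := rfl
  rw [this] at *
  linarith [le_abs_self M, le_abs_self (potential h 1), neg_abs_le C]

lemma exists_finset_of_cyclicallyReduced (hh : IsInvariantSubmodular h) (hr : 1 < r) {C : ℝ}
    (hC : ∀ n, C ≤ potential h (n + 1)) (hunb : ∀ M, ∃ n, M ≤ h (ballFin r n))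
    {L : List (Fin r × Bool)} (hL : FreeGroup.IsCyclicallyReduced L) (hL0 : L ≠ []) (M : ℝ) :
    ∃ E : Finset (FG r), ∀ (k : ℕ) (Q : Finset (FG r)),
      (∀ q ∈ Q, ∃ m < k, ∃ f ∈ E, q = FreeGroup.mk L ^ m * f) →
      M ≤ h (Q ∪ FreeGroup.mk L ^ k • E) - h Q := by
  set s := L.getLast hL0 with hs
  obtain ⟨n, hn⟩ := exists_large_filtered_sum hh hr hC hunb (s.1, !s.2)
    (M + potential h 1 + |C|)
  set E := (sphere r (n + 1)).filter (fun g => g.toWord.head? ≠ some (s.1, !s.2)) with hE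
  have hElen : ∀ g ∈ E, wlen g = n + 1 := fun g hg => mem_sphere.1 (Finset.mem_filter.1 hg).1
  have hred1 : ∀ g ∈ E, FreeGroup.IsReduced (L ++ g.toWord) := by
    intro g hg
    have hne := (Finset.mem_filter.1 hg).2
    refine List.isChain_append.2 ⟨hL.isReduced, FreeGroup.isReduced_toWord, ?_⟩
    intro x hx y hy hxy
    rw [List.getLast?_eq_getLast_of_ne_nil hL0, Option.mem_some_iff, ← hs] at hx
    subst hx
    by_contra hne2
    apply hne
    rw [Option.mem_def.1 hy, Option.some.injEq]
    ext1
    · exact hxy.symm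
    · simpa using (Bool.eq_not_of_ne (Ne.symm hne2))
  have hred : ∀ (k : ℕ), ∀ g ∈ E, FreeGroup.IsReduced ((List.replicate k L).flatten ++ g.toWord) := by
    intro k g hg
    rcases Nat.eq_zero_or_pos k with rfl | hk
    · simpa using FreeGroup.isReduced_toWord
    · simpa using FreeGroup.IsReduced.append_flatten_replicate_append (L₁ := []) hL
        (by simpa using hred1 g hg) hk.ne'
  have hpow : ∀ k : ℕ, (FreeGroup.mk L : FG r) ^ k = FreeGroup.mk (List.replicate k L).flatten :=
    fun k => FreeGroup.pow_mk k
  have hlen : ∀ (k : ℕ), ∀ g ∈ E, wlen (FreeGroup.mk L ^ k * g) = k * L.length + (n + 1) := by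
    intro k g hg
    rw [hpow, wlen, toWord_mk_mul (hred k g hg), List.length_append, ← hElen g hg, wlen]
    simp
  refine ⟨E, fun k Q hQ => ?_⟩
  have h1 := sum_newGain_le hh (P := Q) (E := FreeGroup.mk L ^ k • E) (by
    intro e he q hq
    obtain ⟨g, hg, rfl⟩ := Finset.mem_smul_finset.1 he
    obtain ⟨m, hm, f, hf, rfl⟩ := hQ q hq
    refine mem_preFin.2 (key_lt_of_wlen_lt ?_)
    rw [smul_eq_mul, hlen k g hg, hlen m f hf]
    have : m * L.length < k * L.length :=
      Nat.mul_lt_mul_of_pos_right hm (List.length_pos_iff.2 hL0)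
    omega)
  have h2 := sum_sub_mk_mul_le hh n (List.replicate k L).flatten hElen (hred k)
  rw [Finset.sum_sub_distrib, ← hpow] at h2
  have h3 : ∑ e ∈ FreeGroup.mk L ^ k • E, newGain h e
      = ∑ g ∈ E, newGain h (FreeGroup.mk L ^ k * g) := by
    rw [Finset.smul_finset_def, Finset.sum_image (fun _ _ _ _ => by simp)]
    rfl
  rw [h3] at h1
  have h4 := potential_succ_le hh hr n
  have h5 := hC (n + (List.replicate k L).flatten.length)
  rw [show n + (List.replicate k L).flatten.length + 1
    = n + 1 + (List.replicate k L).flatten.length by omega] at h5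
  linarith [neg_abs_le C]

lemma exists_finset_large_gain (hh : IsInvariantSubmodular h) (hr : 1 < r) {C : ℝ}
    (hC : ∀ n, C ≤ (1 - 2 * r) * h (ballFin r n)
      + ∑ i : Fin r, h (FreeGroup.of i • ballFin r n ∪ ballFin r n))
    (hunb : ∀ M, ∃ n, M ≤ h (ballFin r n)) {g : FG r} (hg : g ≠ 1) (M : ℝ) :
    ∃ E : Finset (FG r), ∀ k : ℕ,
      M ≤ h (E ∪ Finset.univ.biUnion fun m : Fin k => (g ^ (m.1 + 1))⁻¹ • E)
        - h (Finset.univ.biUnion fun m : Fin k => (g ^ (m.1 + 1))⁻¹ • E) := by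
  set L := FreeGroup.reduceCyclically g.toWord with hL
  set u : FG r := FreeGroup.mk (FreeGroup.reduceCyclically.conjugator g.toWord) with hu
  have hconj : u * FreeGroup.mk L * u⁻¹ = g := by
    conv_rhs => rw [← FreeGroup.mk_toWord (x := g),
      ← FreeGroup.reduceCyclically.conj_conjugator_reduceCyclically g.toWord]
    rw [hu, hL, FreeGroup.inv_mk, FreeGroup.mul_mk, FreeGroup.mul_mk]
  have hL0 : L ≠ [] := by
    intro h0
    apply hg
    rw [← hconj, h0, ← FreeGroup.one_eq_mk]
    simp
  have hC' : ∀ n, 2 * C ≤ potential h (n + 1) := fun n =>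
    (mul_le_mul_of_nonneg_left (hC (n + 1)) two_pos.le).trans (potential_lower_bound hh n)
  obtain ⟨E, hE⟩ := exists_finset_of_cyclicallyReduced hh hr hC' hunb
    (FreeGroup.reduceCyclically.isCyclicallyReduced FreeGroup.isReduced_toWord) hL0 M
  set c : FG r := FreeGroup.mk L with hc
  refine ⟨u • E, fun k => ?_⟩
  set Q := Finset.univ.biUnion fun m : Fin k => (g ^ (m.1 + 1))⁻¹ • u • E with hQ
  have hgu : ∀ m : ℕ, g ^ m = u * c ^ m * u⁻¹ := by
    intro m
    rw [← hconj, conj_pow]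
  have hmul : (c ^ k * u⁻¹) • (u • E) = c ^ k • E := by
    rw [smul_smul, inv_mul_cancel_right]
  have h1 := hE k ((c ^ k * u⁻¹) • Q) (by
    intro q hq
    obtain ⟨x, hx, rfl⟩ := Finset.mem_smul_finset.1 hq
    obtain ⟨m, -, hm⟩ := Finset.mem_biUnion.1 hx
    rw [smul_smul] at hm
    obtain ⟨f, hf, rfl⟩ := Finset.mem_smul_finset.1 hm
    refine ⟨k - (m.1 + 1), by omega, f, hf, ?_⟩
    rw [hgu, pow_sub c (show m.1 + 1 ≤ k by omega)]
    simp only [smul_eq_mul]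
    group)
  rw [← hmul, ← Finset.smul_finset_union, hh.smul, hh.smul, Finset.union_comm] at h1
  exact h1

end Combinatorics

section Entropy

lemma measurableSet_fiber_prodMk {X I J : Type*} [MeasurableSpace X] {a : X → I} {b : X → J}
    (ha : ∀ i, MeasurableSet (a ⁻¹' {i})) (hb : ∀ i, MeasurableSet (b ⁻¹' {i})) (p : I × J) :
    MeasurableSet ((fun x => (a x, b x)) ⁻¹' {p}) := by
  have : (fun x => (a x, b x)) ⁻¹' {p} = a ⁻¹' {p.1} ∩ b ⁻¹' {p.2} := by
    ext x; simp [Prod.ext_iff]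
  rw [this]
  exact (ha _).inter (hb _)

variable {X I J K : Type*} [MeasurableSpace X] [Countable I] [Countable J] [Countable K]
  {μ : Measure X} {a : X → I} {b : X → J} {c : X → K}

lemma lintegral_comp_partition (μ : Measure X) (ha : ∀ i, MeasurableSet (a ⁻¹' {i}))
    (φ : I → ℝ≥0∞) : ∫⁻ x, φ (a x) ∂μ = ∑' i, φ i * μ (a ⁻¹' {i}) := by
  let _ : MeasurableSpace I := ⊤
  have hm : Measurable a := measurable_to_countable' ha
  rw [← lintegral_map (measurable_from_top (f := φ)) hm, lintegral_countable']
  refine tsum_congr fun i => ?_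
  rw [Measure.map_apply hm (MeasurableSet.singleton i)]

lemma tsum_measure_inter (μ : Measure X) (ha : ∀ i, MeasurableSet (a ⁻¹' {i})) (C : Set X) :
    ∑' i, μ (a ⁻¹' {i} ∩ C) = μ C := by
  have h := lintegral_comp_partition (μ.restrict C) ha fun _ => 1
  rw [lintegral_one, Measure.restrict_apply_univ] at h
  rw [h]
  refine tsum_congr fun i => ?_
  rw [one_mul, Measure.restrict_apply (ha i)]

lemma tsum_measure_inter' (μ : Measure X) (ha : ∀ i, MeasurableSet (a ⁻¹' {i})) :
    ∑' i, μ (a ⁻¹' {i}) = μ univ := by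
  simpa using tsum_measure_inter μ ha univ

lemma ae_measure_fiber_ne_zero (μ : Measure X) (a : X → I) :
    ∀ᵐ x ∂μ, μ (a ⁻¹' {a x}) ≠ 0 := by
  have h : ∀ i, ∀ᵐ x ∂μ, a x = i → μ (a ⁻¹' {i}) ≠ 0 := by
    intro i
    by_cases hi : μ (a ⁻¹' {i}) = 0
    · refine measure_mono_null (fun x hx => ?_) hi
      have hx' : ¬ (a x = i → μ (a ⁻¹' {i}) ≠ 0) := hx
      rw [Classical.not_imp] at hx'
      exact hx'.1
    · exact Eventually.of_forall fun _ _ => hi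
  filter_upwards [ae_all_iff.2 h] with x hx using hx (a x) rfl

lemma measurable_information (ha : ∀ i, MeasurableSet (a ⁻¹' {i})) :
    Measurable fun x => ENNReal.ofReal (-Real.log (μ (a ⁻¹' {a x})).toReal) := by
  let _ : MeasurableSpace I := ⊤
  have hm : Measurable a := measurable_to_countable' ha
  exact (measurable_from_top (f := fun i => ENNReal.ofReal (-Real.log (μ (a ⁻¹' {i})).toReal))).comp
    hm

lemma Hpart_comp {S : X → X} (hS : MeasurePreserving S μ μ)
    (ha : ∀ i, MeasurableSet (a ⁻¹' {i})) : Hpart μ (fun x => a (S x)) = Hpart μ a := by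
  refine tsum_congr fun i => ?_
  rw [← hS.measure_preimage (ha i).nullMeasurableSet]
  rfl

variable [IsProbabilityMeasure μ]

lemma ofReal_negMulLog_measure (A : Set X) :
    ENNReal.ofReal (Real.negMulLog (μ A).toReal)
      = ENNReal.ofReal (-Real.log (μ A).toReal) * μ A := by
  rw [Real.negMulLog, neg_mul, mul_comm, ← neg_mul, ENNReal.ofReal_mul' ENNReal.toReal_nonneg,
    ENNReal.ofReal_toReal (measure_ne_top μ A)]

lemma Hpart_eq_lintegral (ha : ∀ i, MeasurableSet (a ⁻¹' {i})) :
    Hpart μ a = ∫⁻ x, ENNReal.ofReal (-Real.log (μ (a ⁻¹' {a x})).toReal) ∂μ := by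
  rw [lintegral_comp_partition μ ha fun i => ENNReal.ofReal (-Real.log (μ (a ⁻¹' {i})).toReal)]
  exact tsum_congr fun i => ofReal_negMulLog_measure _

lemma information_mono {A B : Set X} (hAB : A ⊆ B) (hA : μ A ≠ 0) :
    ENNReal.ofReal (-Real.log (μ B).toReal) ≤ ENNReal.ofReal (-Real.log (μ A).toReal) := by
  refine ENNReal.ofReal_le_ofReal (neg_le_neg ?_)
  exact Real.log_le_log (ENNReal.toReal_pos hA (measure_ne_top μ A))
    (ENNReal.toReal_mono (measure_ne_top μ B) (measure_mono hAB))

lemma Hpart_le_of_refines (ha : ∀ i, MeasurableSet (a ⁻¹' {i}))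
    (hb : ∀ i, MeasurableSet (b ⁻¹' {i})) (hab : ∀ x y, b x = b y → a x = a y) :
    Hpart μ a ≤ Hpart μ b := by
  rw [Hpart_eq_lintegral ha, Hpart_eq_lintegral hb]
  refine lintegral_mono_ae ?_
  filter_upwards [ae_measure_fiber_ne_zero μ b] with x hx
  exact information_mono (fun y hy => hab y x hy) hx

lemma Hpart_congr (ha : ∀ i, MeasurableSet (a ⁻¹' {i}))
    (hb : ∀ i, MeasurableSet (b ⁻¹' {i})) (hab : ∀ x y, b x = b y ↔ a x = a y) :
    Hpart μ a = Hpart μ b :=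
  le_antisymm (Hpart_le_of_refines ha hb fun x y => (hab x y).1)
    (Hpart_le_of_refines hb ha fun x y => (hab x y).2)

lemma information_submodular {A B C D : Set X} (hDA : D ⊆ A) (hDB : D ⊆ B) (hDC : D ⊆ C)
    (hD : μ D ≠ 0) :
    ENNReal.ofReal (-Real.log (μ D).toReal) + ENNReal.ofReal (-Real.log (μ C).toReal) + 1
      ≤ ENNReal.ofReal (-Real.log (μ A).toReal) + ENNReal.ofReal (-Real.log (μ B).toReal)
        + μ A * μ B * (μ C)⁻¹ * (μ D)⁻¹ := by
  have pos : ∀ {E : Set X}, D ⊆ E → 0 < (μ E).toReal := fun hE =>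
    ENNReal.toReal_pos (fun h0 => hD (measure_mono_null hE h0)) (measure_ne_top μ _)
  have le1 : ∀ E : Set X, (μ E).toReal ≤ 1 := fun E => by
    simpa using ENNReal.toReal_mono ENNReal.one_ne_top (prob_le_one (μ := μ) (s := E))
  have nn : ∀ E : Set X, 0 ≤ -Real.log (μ E).toReal := fun E =>
    neg_nonneg.2 (Real.log_nonpos ENNReal.toReal_nonneg (le1 E))
  have hC : μ C ≠ 0 := fun h0 => hD (measure_mono_null hDC h0)
  have hfin : μ A * μ B * (μ C)⁻¹ * (μ D)⁻¹ ≠ ⊤ := by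
    have := measure_ne_top μ A
    have := measure_ne_top μ B
    finiteness
  have hquot : μ A * μ B * (μ C)⁻¹ * (μ D)⁻¹ = ENNReal.ofReal
      ((μ A).toReal * (μ B).toReal * (μ C).toReal⁻¹ * (μ D).toReal⁻¹) := by
    rw [← ENNReal.ofReal_toReal hfin]
    simp only [ENNReal.toReal_mul, ENNReal.toReal_inv]
  have pA := pos hDA
  have pB := pos hDB
  have pC := pos hDC
  have pD := pos Subset.rfl
  rw [hquot, ← ENNReal.ofReal_one, ← ENNReal.ofReal_add (nn _) (nn _),
    ← ENNReal.ofReal_add (add_nonneg (nn _) (nn _)) zero_le_one, ← ENNReal.ofReal_add (nn _) (nn _),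
    ← ENNReal.ofReal_add (add_nonneg (nn _) (nn _)) (by positivity)]
  refine ENNReal.ofReal_le_ofReal ?_
  have hlog := Real.log_le_sub_one_of_pos
    (show 0 < (μ A).toReal * (μ B).toReal * (μ C).toReal⁻¹ * (μ D).toReal⁻¹ by positivity)
  rw [Real.log_mul (by positivity) (by positivity), Real.log_mul (by positivity) (by positivity),
    Real.log_mul (by positivity) (by positivity), Real.log_inv, Real.log_inv] at hlog
  linarith

/-- Strong subadditivity of Shannon entropy. -/
lemma Hpart_submodular (ha : ∀ i, MeasurableSet (a ⁻¹' {i}))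
    (hb : ∀ i, MeasurableSet (b ⁻¹' {i})) (hc : ∀ i, MeasurableSet (c ⁻¹' {i})) :
    Hpart μ (fun x => (a x, b x, c x)) + Hpart μ c
      ≤ Hpart μ (fun x => (a x, c x)) + Hpart μ (fun x => (b x, c x)) := by
  have hac := measurableSet_fiber_prodMk ha hc
  have hbc := measurableSet_fiber_prodMk hb hc
  have habc := measurableSet_fiber_prodMk ha hbc
  set φ : I × J × K → ℝ≥0∞ := fun q =>
    μ ((fun x => (a x, c x)) ⁻¹' {(q.1, q.2.2)}) * μ ((fun x => (b x, c x)) ⁻¹' {q.2})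
      * (μ (c ⁻¹' {q.2.2}))⁻¹ * (μ ((fun x => (a x, b x, c x)) ⁻¹' {q}))⁻¹ with hφ
  have hφ1 : ∫⁻ x, φ (a x, b x, c x) ∂μ ≤ 1 := by
    rw [lintegral_comp_partition μ habc φ]
    calc ∑' q, φ q * μ ((fun x => (a x, b x, c x)) ⁻¹' {q})
        ≤ ∑' q : I × J × K, μ (a ⁻¹' {q.1} ∩ c ⁻¹' {q.2.2})
            * (μ (b ⁻¹' {q.2.1} ∩ c ⁻¹' {q.2.2}) * (μ (c ⁻¹' {q.2.2}))⁻¹) := by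
          refine ENNReal.tsum_le_tsum fun q => ?_
          have e1 : (fun x => (a x, c x)) ⁻¹' {(q.1, q.2.2)} = a ⁻¹' {q.1} ∩ c ⁻¹' {q.2.2} := by
            ext x; simp
          have e2 : (fun x => (b x, c x)) ⁻¹' {q.2} = b ⁻¹' {q.2.1} ∩ c ⁻¹' {q.2.2} := by
            ext x; simp [Prod.ext_iff]
          rw [hφ]
          simp only
          rw [e1, e2, mul_assoc _ _ (μ _), ← mul_assoc (μ (a ⁻¹' {q.1} ∩ _))]
          calc _ ≤ μ (a ⁻¹' {q.1} ∩ c ⁻¹' {q.2.2}) * μ (b ⁻¹' {q.2.1} ∩ c ⁻¹' {q.2.2})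
                * (μ (c ⁻¹' {q.2.2}))⁻¹ * 1 := by
                gcongr
                exact ENNReal.inv_mul_le_one _
            _ = _ := mul_one _
      _ = ∑' k, μ (c ⁻¹' {k}) * (μ (c ⁻¹' {k}) * (μ (c ⁻¹' {k}))⁻¹) := by
          rw [ENNReal.tsum_prod', ENNReal.tsum_comm, ENNReal.tsum_prod', ENNReal.tsum_comm]
          refine tsum_congr fun k => ?_
          simp only [ENNReal.tsum_mul_right, ENNReal.tsum_mul_left, tsum_measure_inter μ ha,
            tsum_measure_inter μ hb]
      _ ≤ ∑' k, μ (c ⁻¹' {k}) := by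
          refine ENNReal.tsum_le_tsum fun k => ?_
          calc _ ≤ μ (c ⁻¹' {k}) * 1 := by
                gcongr
                exact ENNReal.mul_inv_le_one _
            _ = _ := mul_one _
      _ = 1 := by rw [tsum_measure_inter' μ hc, measure_univ]
  have hpt : ∀ᵐ x ∂μ,
      ENNReal.ofReal (-Real.log (μ ((fun x => (a x, b x, c x)) ⁻¹' {(a x, b x, c x)})).toReal)
        + ENNReal.ofReal (-Real.log (μ (c ⁻¹' {c x})).toReal) + 1
      ≤ ENNReal.ofReal (-Real.log (μ ((fun x => (a x, c x)) ⁻¹' {(a x, c x)})).toReal)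
        + ENNReal.ofReal (-Real.log (μ ((fun x => (b x, c x)) ⁻¹' {(b x, c x)})).toReal)
        + φ (a x, b x, c x) := by
    filter_upwards [ae_measure_fiber_ne_zero μ fun x => (a x, b x, c x)] with x hx
    refine information_submodular ?_ ?_ ?_ hx
    all_goals
      intro y hy
      simp only [mem_preimage, mem_singleton_iff, Prod.mk.injEq] at hy ⊢
      tauto
  have hadd : Measurable fun x =>
      ENNReal.ofReal (-Real.log (μ ((fun x => (a x, c x)) ⁻¹' {(a x, c x)})).toReal)
        + ENNReal.ofReal (-Real.log (μ ((fun x => (b x, c x)) ⁻¹' {(b x, c x)})).toReal) :=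
    (measurable_information hac).add (measurable_information hbc)
  have hintegral := lintegral_mono_ae hpt
  rw [lintegral_add_right _ measurable_const, lintegral_add_left (measurable_information habc),
    lintegral_add_left hadd, lintegral_add_left (measurable_information hac), lintegral_one, measure_univ,
    ← Hpart_eq_lintegral hac, ← Hpart_eq_lintegral hbc, ← Hpart_eq_lintegral hc,
    ← Hpart_eq_lintegral habc] at hintegral
  exact (ENNReal.add_le_add_iff_right ENNReal.one_ne_top).1 (hintegral.trans (add_le_add_right hφ1 _))

lemma Hpart_prodMk_le_add (ha : ∀ i, MeasurableSet (a ⁻¹' {i}))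
    (hb : ∀ i, MeasurableSet (b ⁻¹' {i})) :
    Hpart μ (fun x => (a x, b x)) ≤ Hpart μ a + Hpart μ b := by
  have hu : ∀ i : Unit, MeasurableSet ((fun _ : X => ()) ⁻¹' {i}) := fun i => by simp
  have h := Hpart_submodular (μ := μ) ha hb hu
  have hau := measurableSet_fiber_prodMk ha hu
  have hbu := measurableSet_fiber_prodMk hb hu
  rw [Hpart_congr hau ha (by simp), Hpart_congr hbu hb (by simp),
    Hpart_congr (measurableSet_fiber_prodMk ha hbu) (measurableSet_fiber_prodMk ha hb)
      (by simp)] at h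
  exact le_self_add.trans h

lemma Hpart_prodMk_le_condEntP_add (hb : ∀ i, MeasurableSet (b ⁻¹' {i})) :
    Hpart μ (fun x => (b x, c x)) ≤ condEntP μ b c + Hpart μ c := by
  have h1 : Hpart μ c = ∑' q : J × K, ENNReal.ofReal (-Real.log (μ (c ⁻¹' {q.2})).toReal)
      * μ (b ⁻¹' {q.1} ∩ c ⁻¹' {q.2}) := by
    rw [ENNReal.tsum_prod', ENNReal.tsum_comm]
    refine tsum_congr fun k => ?_
    simp only [ENNReal.tsum_mul_left, tsum_measure_inter μ hb]
    exact ofReal_negMulLog_measure _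
  rw [h1, condEntP, ← ENNReal.tsum_add]
  refine ENNReal.tsum_le_tsum fun q => ?_
  have e1 : (fun x => (b x, c x)) ⁻¹' {q} = b ⁻¹' {q.1} ∩ c ⁻¹' {q.2} := by
    ext x; simp [Prod.ext_iff]
  rw [e1]
  set P := b ⁻¹' {q.1} ∩ c ⁻¹' {q.2}
  set Q := c ⁻¹' {q.2}
  by_cases hP : μ P = 0
  · simp [hP]
  have hQ : μ Q ≠ 0 := fun h0 => hP (measure_mono_null inter_subset_right h0)
  have pP := ENNReal.toReal_pos hP (measure_ne_top μ P)
  have pQ := ENNReal.toReal_pos hQ (measure_ne_top μ Q)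
  have e2 : μ Q * ENNReal.ofReal (Real.negMulLog ((μ P).toReal / (μ Q).toReal))
      = ENNReal.ofReal ((μ Q).toReal * Real.negMulLog ((μ P).toReal / (μ Q).toReal)) := by
    rw [ENNReal.ofReal_mul pQ.le, ENNReal.ofReal_toReal (measure_ne_top μ Q)]
  have e3 : ENNReal.ofReal (-Real.log (μ Q).toReal) * μ P
      = ENNReal.ofReal (-Real.log (μ Q).toReal * (μ P).toReal) := by
    rw [ENNReal.ofReal_mul' pP.le, ENNReal.ofReal_toReal (measure_ne_top μ P)]
  rw [e2, e3]
  refine le_trans (ENNReal.ofReal_le_ofReal (le_of_eq ?_)) ENNReal.ofReal_add_le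
  rw [Real.negMulLog, Real.negMulLog, Real.log_div pP.ne' pQ.ne']
  field_simp
  ring

end Entropy

section Action

variable {G X : Type*} [Group G] [MeasurableSpace X] {T : BorelAction G X} {a : X → ℕ}

lemma joinF_eq_joinF_iff {F : Set G} {x y : X} :
    T.joinF F a x = T.joinF F a y ↔ ∀ f ∈ F, a (T.act f⁻¹ x) = a (T.act f⁻¹ y) := by
  simp [funext_iff, BorelAction.joinF]

lemma measurableSet_fiber_joinF (ha : Measurable a) (F : Set G) [Finite F] (p : F → ℕ) :
    MeasurableSet (T.joinF F a ⁻¹' {p}) := by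
  have h : Measurable (T.joinF F a) :=
    measurable_pi_lambda _ fun f => ha.comp (T.measurable_act _)
  exact h (MeasurableSet.singleton p)

lemma mem_iff_mem_of_partSA {B : Set X} (hB : MeasurableSet[T.partSA univ a] B) {x y : X}
    (hxy : ∀ g : G, a (T.act g⁻¹ x) = a (T.act g⁻¹ y)) : x ∈ B ↔ y ∈ B := by
  have hle : T.partSA univ a
      ≤ MeasurableSpace.comap (fun x (g : G) => a (T.act g⁻¹ x)) ⊤ := by
    refine iSup₂_le fun f _ => ?_
    rintro _ ⟨C, -, rfl⟩
    exact ⟨(fun q : G → ℕ => q f) ⁻¹' C, trivial, rfl⟩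
  obtain ⟨C, -, rfl⟩ := hle B hB
  rw [mem_preimage, mem_preimage, funext hxy]

variable {μ : Measure X} [IsProbabilityMeasure μ]

lemma Hpart_joinF_lt_top [DecidableEq G] (hT : T.Preserves μ) (ha : Measurable a)
    (hH : Hpart μ a < ⊤) (E : Finset G) : Hpart μ (T.joinF (E : Set G) a) < ⊤ := by
  have ha' : ∀ i, MeasurableSet (a ⁻¹' {i}) := fun i => ha (MeasurableSet.singleton i)
  induction E using Finset.induction_on with
  | empty =>
    refine lt_of_le_of_lt (Hpart_le_of_refines (measurableSet_fiber_joinF ha _) ha' ?_) hH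
    intro x y _
    rw [joinF_eq_joinF_iff]
    simp
  | insert g E _ ih =>
    have hg : ∀ i, MeasurableSet (T.tr g a ⁻¹' {i}) := fun i => T.measurable_act _ (ha' i)
    have hgH : Hpart μ (T.tr g a) = Hpart μ a := Hpart_comp (hT g⁻¹) ha'
    have hE := measurableSet_fiber_joinF (T := T) ha (E : Set G)
    refine lt_of_le_of_lt ((Hpart_le_of_refines (measurableSet_fiber_joinF ha _)
      (measurableSet_fiber_prodMk hg hE) ?_).trans (Hpart_prodMk_le_add hg hE)) ?_
    · intro x y hxy
      rw [Prod.mk.injEq, joinF_eq_joinF_iff] at hxy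
      rw [joinF_eq_joinF_iff]
      intro f hf
      rcases Finset.mem_insert.1 (Finset.mem_coe.1 hf) with rfl | hf
      · exact hxy.1
      · exact hxy.2 f hf
    · rw [hgH]
      exact ENNReal.add_lt_top.2 ⟨hH, ih⟩

/-- The Shannon entropy of the join of the translates of `a` over a finite set. -/
noncomputable def joinEntropy (μ : Measure X) (T : BorelAction G X) (a : X → ℕ)
    (E : Finset G) : ℝ := (Hpart μ (T.joinF (E : Set G) a)).toReal

lemma toReal_Hpart_eq_joinEntropy {I : Type*} [Countable I] {b : X → I} (ha : Measurable a)
    (hb : ∀ i, MeasurableSet (b ⁻¹' {i})) {E : Finset G}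
    (hbE : ∀ x y, b x = b y ↔ ∀ f ∈ E, a (T.act f⁻¹ x) = a (T.act f⁻¹ y)) :
    (Hpart μ b).toReal = joinEntropy μ T a E := by
  rw [joinEntropy, Hpart_congr (measurableSet_fiber_joinF ha _) hb]
  intro x y
  rw [hbE, joinF_eq_joinF_iff]
  rfl

lemma isInvariantSubmodular_joinEntropy [DecidableEq G] (hT : T.Preserves μ) (ha : Measurable a)
    (hH : Hpart μ a < ⊤) : IsInvariantSubmodular (joinEntropy μ T a) := by
  have hfin := fun E => (Hpart_joinF_lt_top hT ha hH E).ne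
  have hm := fun E : Finset G => measurableSet_fiber_joinF (T := T) ha (E : Set G)
  refine ⟨fun A B hAB => ?_, fun A B => ?_, fun g A => ?_, ?_⟩
  · refine ENNReal.toReal_mono (hfin B) (Hpart_le_of_refines (hm A) (hm B) fun x y hxy => ?_)
    rw [joinF_eq_joinF_iff] at hxy ⊢
    exact fun f hf => hxy f (hAB hf)
  · have h1 := Hpart_submodular (μ := μ) (hm A) (hm B) (hm (A ∩ B))
    rw [Hpart_congr (b := T.joinF (A : Set G) a)
        (measurableSet_fiber_prodMk (hm A) (hm (A ∩ B))) (hm A),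
      Hpart_congr (b := T.joinF (B : Set G) a)
        (measurableSet_fiber_prodMk (hm B) (hm (A ∩ B))) (hm B),
      Hpart_congr (b := T.joinF ((A ∪ B : Finset G) : Set G) a)
        (measurableSet_fiber_prodMk (hm A) (measurableSet_fiber_prodMk (hm B) (hm (A ∩ B))))
        (hm (A ∪ B))] at h1
    · have h2 := ENNReal.toReal_mono (ENNReal.add_ne_top.2 ⟨hfin A, hfin B⟩) h1
      rwa [ENNReal.toReal_add (hfin _) (hfin _), ENNReal.toReal_add (hfin _) (hfin _)] at h2
    all_goals
      intro x y
      simp only [Prod.mk.injEq, joinF_eq_joinF_iff, Finset.mem_coe, Finset.mem_union,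
        Finset.mem_inter]
      grind
  · rw [← toReal_Hpart_eq_joinEntropy (b := fun x => T.joinF (A : Set G) a (T.act g⁻¹ x)) ha,
      Hpart_comp (hT g⁻¹) (hm A), joinEntropy]
    · exact fun i => T.measurable_act _ (hm A i)
    · intro x y
      rw [joinF_eq_joinF_iff]
      simp only [← T.act_mul, ← mul_inv_rev, Finset.mem_coe]
      constructor
      · intro h f hf
        obtain ⟨k, hk, rfl⟩ := Finset.mem_smul_finset.1 hf
        exact h k hk
      · exact fun h f hf => h (g * f) (Finset.smul_mem_smul_finset hf)
  · rw [← toReal_Hpart_eq_joinEntropy (b := fun _ : X => ()) ha (fun i => by simp) (by simp)]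
    simp [Hpart]

lemma purelyAtomic_of_bounded_entropy {r : ℕ} [StandardBorelSpace X] {T : BorelAction (FG r) X}
    (ha : Measurable a) (hgen : T.Generating a μ) {C : ℝ≥0∞} (hC : C ≠ ⊤)
    (hb : ∀ n, Hpart μ (T.joinF (ball r n) a) ≤ C) : PurelyAtomic μ := by
  have hm := fun n => measurableSet_fiber_joinF (T := T) ha (ball r n)
  set fib : ℕ → X → Set X := fun n x => T.joinF (ball r n) a ⁻¹' {T.joinF (ball r n) a x} with hfib
  have hanti : ∀ x, Antitone fun n => fib n x := by
    intro x m n hmn y hy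
    simp only [hfib, mem_preimage, mem_singleton_iff, joinF_eq_joinF_iff] at hy ⊢
    exact fun f hf => hy f (le_trans (show wlen f ≤ m from hf) hmn)
  have hlim : ∀ᵐ x ∂μ, ⨆ n, ENNReal.ofReal (-Real.log (μ (fib n x)).toReal) < ⊤ := by
    refine ae_lt_top (Measurable.iSup fun n => measurable_information (hm n)) (ne_of_lt ?_)
    rw [lintegral_iSup_ae fun n => measurable_information (hm n)]
    · refine lt_of_le_of_lt (iSup_le fun n => ?_) (lt_top_iff_ne_top.2 hC)
      rw [← Hpart_eq_lintegral (hm n)]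
      exact hb n
    · intro n
      filter_upwards [ae_measure_fiber_ne_zero μ (T.joinF (ball r (n + 1)) a)] with x hx
      exact information_mono (hanti x n.le_succ) hx
  have hpos : ∀ᵐ x ∂μ, ∀ n, μ (fib n x) ≠ 0 :=
    ae_all_iff.2 fun n => ae_measure_fiber_ne_zero μ (T.joinF (ball r n) a)
  obtain ⟨U, hU, hsep⟩ := exists_seq_separating X (p := MeasurableSet) MeasurableSet.empty univ
  choose U' hU' hUU' using fun k => hgen (U k) (hU k)
  have hagree : ∀ᵐ x ∂μ, ∀ k, (x ∈ U k ↔ x ∈ U' k) :=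
    ae_all_iff.2 fun k => (measure_symmDiff_eq_zero_iff.1 (hUU' k)).mem_iff
  have hatoms : ∀ᵐ x ∂μ, 0 < μ {x} := by
    filter_upwards [hlim, hpos, hagree] with x hx hx0 hxU
    have hfibpos : 0 < μ (⋂ n, fib n x) := by
      rw [(hanti x).measure_iInter (fun n => (hm n _).nullMeasurableSet)
        ⟨0, measure_ne_top μ _⟩]
      set c := (⨆ n, ENNReal.ofReal (-Real.log (μ (fib n x)).toReal)).toReal with hc
      refine lt_of_lt_of_le (ENNReal.ofReal_pos.2 (Real.exp_pos (-c))) (le_iInf fun n => ?_)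
      rw [ENNReal.ofReal_le_iff_le_toReal (measure_ne_top μ _),
        ← Real.le_log_iff_exp_le (ENNReal.toReal_pos (hx0 n) (measure_ne_top μ _)), neg_le, hc,
        ← ENNReal.ofReal_le_iff_le_toReal hx.ne]
      exact le_iSup (fun n => ENNReal.ofReal (-Real.log (μ (fib n x)).toReal)) n
    refine lt_of_lt_of_le hfibpos (measure_mono_ae ?_)
    filter_upwards [hagree] with y hyU hy
    refine hsep y trivial x trivial fun k => ?_
    rw [hyU, hxU]
    refine mem_iff_mem_of_partSA (hU' k) fun g => ?_
    exact joinF_eq_joinF_iff.1 (mem_iInter.1 hy (wlen g)) g (le_refl (wlen g))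
  have huniv : {x | 0 < μ {x}} =ᵐ[μ] univ := eventuallyEq_univ.2 hatoms
  rw [PurelyAtomic, measure_congr huniv, measure_univ]

end Action

/-- If `f_G(X,μ)` is defined and finite and `μ` is not purely atomic,
then every non-trivial cyclic subgroup acts with infinite Kolmogorov–Sinai entropy. -/
theorem statement5 {r : ℕ} (hr : 1 < r) {X : Type*}
    [mX : MeasurableSpace X] [StandardBorelSpace X]
    (μ : Measure X) [IsProbabilityMeasure μ]
    (T : BorelAction (FG r) X) (hT : T.Preserves μ)
    (hdef : ∃ a : X → ℕ, Measurable a ∧ T.Generating a μ ∧ Hpart μ a < ⊤ ∧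
      fInv μ T a ≠ ⊥)
    (hatom : ¬ PurelyAtomic μ) :
    ∀ g : FG r, g ≠ 1 →
      (⨆ (b : X → ℕ) (_ : Measurable b) (_ : Hpart μ b < ⊤),
        ⨅ k : ℕ, condEntP μ b (fun x (m : Fin k) => b (T.act (g ^ (m.1 + 1)) x))) = ⊤ := by
  intro g hg
  obtain ⟨a, ha, hgen, hH, hf⟩ := hdef
  set h := joinEntropy μ T a with hh
  have hfin := fun E => (Hpart_joinF_lt_top hT ha hH E).ne
  have hm := fun E : Finset (FG r) => measurableSet_fiber_joinF (T := T) ha (E : Set (FG r))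
  have hball : ∀ n, (Hpart μ (T.joinF (ball r n) a)).toReal = h (ballFin r n) := fun n =>
    toReal_Hpart_eq_joinEntropy ha (measurableSet_fiber_joinF ha _) fun x y => by
      simp only [joinF_eq_joinF_iff, mem_ballFin, ball, mem_ofPred_eq]
  have hseq : ∀ n, fSeq μ T a n = (1 - 2 * r) * h (ballFin r n)
      + ∑ i : Fin r, h (FreeGroup.of i • ballFin r n ∪ ballFin r n) := by
    intro n
    rw [fSeq, FF, hball]
    congr 1
    refine Finset.sum_congr rfl fun i _ => toReal_Hpart_eq_joinEntropy ha ?_ fun x y => ?_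
    · have hB := measurableSet_fiber_joinF (T := T) ha (ball r n)
      exact measurableSet_fiber_prodMk (fun j => T.measurable_act _ (hB j)) hB
    · simp only [Prod.mk.injEq, BorelAction.tr, joinF_eq_joinF_iff, ← T.act_mul, ← mul_inv_rev,
        Finset.mem_union, Finset.mem_smul_finset, mem_ballFin, ball, mem_ofPred_eq, smul_eq_mul]
      grind
  obtain ⟨C, -, hC⟩ := EReal.lt_iff_exists_real_btwn.1 (bot_lt_iff_ne_bot.2 hf)
  have hC' : ∀ n, C ≤ (1 - 2 * r) * h (ballFin r n)
      + ∑ i : Fin r, h (FreeGroup.of i • ballFin r n ∪ ballFin r n) := fun n => by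
    rw [← hseq]
    exact EReal.coe_le_coe_iff.1 (hC.le.trans (iInf_le _ n))
  have hunb : ∀ M, ∃ n, M ≤ h (ballFin r n) := by
    by_contra! hcon
    obtain ⟨M, hM⟩ := hcon
    refine hatom (purelyAtomic_of_bounded_entropy ha hgen (C := ENNReal.ofReal M)
      ENNReal.ofReal_ne_top fun n => ?_)
    have hne : Hpart μ (T.joinF (ball r n) a) ≠ ⊤ := by
      have := hfin (ballFin r n)
      rwa [Hpart_congr (hm _) (measurableSet_fiber_joinF ha (ball r n))] at this
      intro x y
      simp only [joinF_eq_joinF_iff, Finset.mem_coe, mem_ballFin, ball, mem_ofPred_eq]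
    rw [← ENNReal.ofReal_toReal hne, hball]
    exact ENNReal.ofReal_le_ofReal (hM n).le
  refine ENNReal.eq_top_of_forall_nnreal_le fun M => ?_
  obtain ⟨E, hE⟩ := exists_finset_large_gain (isInvariantSubmodular_joinEntropy hT ha hH) hr hC'
    hunb hg M
  obtain ⟨e, he⟩ := exists_injective_nat (↥(E : Set (FG r)) → ℕ)
  set b : X → ℕ := fun x => e (T.joinF (E : Set (FG r)) a x) with hb
  have hbm : Measurable b := (measurable_of_countable e).comp
    (measurable_pi_lambda (T.joinF (E : Set (FG r)) a) fun f => ha.comp (T.measurable_act _))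
  have hbf : ∀ i, MeasurableSet (b ⁻¹' {i}) := fun i => hbm (MeasurableSet.singleton i)
  have hbH : Hpart μ b < ⊤ := by
    rw [Hpart_congr hbf (hm E) fun x y => he.eq_iff.symm]
    exact (hfin E).lt_top
  refine le_trans (le_iInf fun k => ?_) (le_iSup₂_of_le b hbm (le_iSup_of_le hbH le_rfl))
  set Q := Finset.univ.biUnion fun m : Fin k => (g ^ (m.1 + 1))⁻¹ • E with hQ
  set c : X → Fin k → ℕ := fun x m => b (T.act (g ^ (m.1 + 1)) x) with hc
  have hcf : ∀ p, MeasurableSet (c ⁻¹' {p}) := fun p =>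
    (measurable_pi_lambda c fun m => hbm.comp (T.measurable_act _)) (MeasurableSet.singleton p)
  have hbiff : ∀ x y, b x = b y ↔ ∀ f ∈ E, a (T.act f⁻¹ x) = a (T.act f⁻¹ y) := fun x y => by
    rw [hb, he.eq_iff, joinF_eq_joinF_iff]
    rfl
  have hciff : ∀ x y, c x = c y ↔ ∀ f ∈ Q, a (T.act f⁻¹ x) = a (T.act f⁻¹ y) := by
    intro x y
    simp only [hc, funext_iff, hbiff, hQ, Finset.mem_biUnion, Finset.mem_univ, true_and,
      Finset.mem_smul_finset, smul_eq_mul, ← T.act_mul]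
    constructor
    · rintro hxy _ ⟨m, f, hf, rfl⟩
      simpa using hxy m f hf
    · intro hxy m f hf
      simpa using hxy _ ⟨m, f, hf, rfl⟩
  have hbc := measurableSet_fiber_prodMk hbf hcf
  have hbciff : ∀ x y, (b x, c x) = (b y, c y)
      ↔ ∀ f ∈ E ∪ Q, a (T.act f⁻¹ x) = a (T.act f⁻¹ y) := by
    intro x y
    simp only [Prod.mk.injEq, hbiff, hciff, Finset.mem_union]
    grind
  have hchain := Hpart_prodMk_le_condEntP_add (μ := μ) (c := c) hbf
  by_cases htop : condEntP μ b c = ⊤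
  · rw [htop]
    exact le_top
  have hcH : Hpart μ c ≠ ⊤ := by
    rw [Hpart_congr hcf (hm Q) fun x y => by rw [joinF_eq_joinF_iff, hciff]; rfl]
    exact hfin Q
  have hreal := ENNReal.toReal_mono (ENNReal.add_ne_top.2 ⟨htop, hcH⟩) hchain
  rw [ENNReal.toReal_add htop hcH, toReal_Hpart_eq_joinEntropy ha hbc hbciff,
    toReal_Hpart_eq_joinEntropy ha hcf hciff] at hreal
  rw [← ENNReal.ofReal_coe_nnreal, ENNReal.ofReal_le_iff_le_toReal htop]
  linarith [hE k]

end FPaper
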